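/- For every integer k ≥ 1 there exist real constants C_0, C_1, …, C_k, with C_k = ∫_0^∞ t²(1 + t^{2k})/(1+t²)^{k+3} dt > 0, such that for all h > 0 one has I_k(h) = h(4+h) · Σ_{i=0}^{k} C_i h^i. -/

import Mathlib

open intervalIntegral Real MeasureTheory

/-- The `j`-th moment of the semicircle weight `√(1 - s²)` on `[-1, 1]`. -/
noncomputable def semicircleMoment (j : ℕ) : ℝ :=
  ∫ s in (-1 : ℝ)..1, s ^ j * Real.sqrt (1 - s ^ 2)

theorem semicircleMoment_of_odd {j : ℕ} (hj : Odd j) : semicircleMoment j = 0 := by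
  have h := intervalIntegral.integral_comp_neg (a := (-1 : ℝ)) (b := 1)
    (fun s : ℝ => s ^ j * Real.sqrt (1 - s ^ 2))
  simp only [hj.neg_pow, neg_sq, neg_mul, intervalIntegral.integral_neg, neg_neg] at h
  unfold semicircleMoment
  linarith

theorem integral_linear_pow_mul_semicircle (k : ℕ) (p q : ℝ) :
    ∫ s in (-1 : ℝ)..1, (q * s + p) ^ k * Real.sqrt (1 - s ^ 2) =
      ∑ j ∈ Finset.range (k + 1), q ^ j * p ^ (k - j) * k.choose j * semicircleMoment j := by
  simp only [semicircleMoment, ← intervalIntegral.integral_const_mul]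
  rw [← intervalIntegral.integral_finsetSum]
  · refine intervalIntegral.integral_congr fun s _ => ?_
    simp only [add_pow, Finset.sum_mul]
    refine Finset.sum_congr rfl fun j _ => ?_
    ring
  · intro j _
    exact Continuous.intervalIntegrable (by fun_prop) _ _

theorem integral_linear_pow_mul_sqrt_sq_sub_sq (k : ℕ) (c m r : ℝ) (hr : 0 < r) :
    ∫ y in (m - r)..(m + r), (c + y) ^ k * Real.sqrt (r ^ 2 - (y - m) ^ 2) =
      r ^ 2 * ∫ s in (-1 : ℝ)..1, (r * s + (c + m)) ^ k * Real.sqrt (1 - s ^ 2) := by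
  have h := intervalIntegral.integral_comp_mul_add (a := (-1 : ℝ)) (b := 1)
    (fun y : ℝ => (c + y) ^ k * Real.sqrt (r ^ 2 - (y - m) ^ 2)) hr.ne' m
  rw [show r * -1 + m = m - r by ring, show r * 1 + m = m + r by ring, smul_eq_mul,
    eq_inv_mul_iff_mul_eq₀ hr.ne'] at h
  rw [← h, ← intervalIntegral.integral_const_mul, ← intervalIntegral.integral_const_mul]
  refine intervalIntegral.integral_congr fun s _ => ?_
  have hs : Real.sqrt (r ^ 2 - (r * s + m - m) ^ 2) = r * Real.sqrt (1 - s ^ 2) := by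
    rw [show r ^ 2 - (r * s + m - m) ^ 2 = r ^ 2 * (1 - s ^ 2) by ring,
      Real.sqrt_mul (sq_nonneg r), Real.sqrt_sq hr.le]
  simp only [hs]
  ring

open Polynomial in
/-- The polynomial `p` with `I_k(h) = h (4 + h) p(h)`. -/
noncomputable def cycleIntegralPoly (k : ℕ) : ℝ[X] :=
  ∑ j ∈ Finset.range (k + 1),
    C (k.choose j * semicircleMoment j / 4) *
      ((C (1 / 2) * X + C 1) ^ (k - j) * (C (1 / 4) * X ^ 2 + C 1 * X + C 0) ^ (j / 2))

open Polynomial in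
theorem natDegree_cycleIntegralPoly_le (k : ℕ) : (cycleIntegralPoly k).natDegree ≤ k := by
  refine natDegree_sum_le_of_forall_le _ _ fun j hj => (natDegree_C_mul_le _ _).trans ?_
  have hjk : j < k + 1 := Finset.mem_range.1 hj
  refine (natDegree_mul_le_of_le (natDegree_pow_le_of_le (k - j) natDegree_linear_le)
    (natDegree_pow_le_of_le (j / 2) natDegree_quadratic_le)).trans ?_
  omega

open Polynomial in
theorem coeff_cycleIntegralPoly_self (k : ℕ) :
    (cycleIntegralPoly k).coeff k =
      (∫ s in (-1 : ℝ)..1, (1 / 2 * s + 1 / 2) ^ k * Real.sqrt (1 - s ^ 2)) / 4 := by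
  rw [integral_linear_pow_mul_semicircle, cycleIntegralPoly, finsetSum_coeff, Finset.sum_div]
  refine Finset.sum_congr rfl fun j hj => ?_
  have hjk : j < k + 1 := Finset.mem_range.1 hj
  rw [coeff_C_mul]
  rcases Nat.even_or_odd' j with ⟨i, rfl | rfl⟩
  · have hi : 2 * i / 2 = i := by omega
    have hk : k = (k - 2 * i) * 1 + i * 2 := by omega
    have hcoeff : ((C (1 / 2 : ℝ) * X + C 1) ^ (k - 2 * i) *
        (C (1 / 4 : ℝ) * X ^ 2 + C 1 * X + C 0) ^ i).coeff ((k - 2 * i) * 1 + i * 2) =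
        (1 / 2) ^ (k - 2 * i) * (1 / 4) ^ i := by
      rw [coeff_mul_add_eq_of_natDegree_le (natDegree_pow_le_of_le _ natDegree_linear_le)
        (natDegree_pow_le_of_le _ natDegree_quadratic_le),
        coeff_pow_of_natDegree_le natDegree_linear_le,
        coeff_pow_of_natDegree_le natDegree_quadratic_le]
      simp [coeff_X, coeff_one]
    rw [← hk] at hcoeff
    rw [hi, hcoeff, pow_mul]
    norm_num
    ring
  · rw [semicircleMoment_of_odd (odd_two_mul_add_one i)]
    simp

open Polynomial in
theorem eval_cycleIntegralPoly (k : ℕ) {h r : ℝ} (hr : r ^ 2 = h * (4 + h) / 4) :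
    (cycleIntegralPoly k).eval h =
      (∫ s in (-1 : ℝ)..1, (r * s + (1 + h / 2)) ^ k * Real.sqrt (1 - s ^ 2)) / 4 := by
  rw [integral_linear_pow_mul_semicircle, cycleIntegralPoly, eval_finsetSum, Finset.sum_div]
  refine Finset.sum_congr rfl fun j _ => ?_
  rcases Nat.even_or_odd' j with ⟨i, rfl | rfl⟩
  · have hi : 2 * i / 2 = i := by omega
    simp only [eval_mul, eval_C, eval_pow, eval_add, eval_X, hi, pow_mul r, hr]
    rw [show 1 / 4 * h ^ 2 + 1 * h + 0 = h * (4 + h) / 4 by ring,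
      show 1 / 2 * h + 1 = 1 + h / 2 by ring]
    ring
  · rw [semicircleMoment_of_odd (odd_two_mul_add_one i)]
    simp

theorem integral_half_add_half_pow_mul_semicircle (k : ℕ) :
    (∫ s in (-1 : ℝ)..1, (1 / 2 * s + 1 / 2) ^ k * Real.sqrt (1 - s ^ 2)) =
      4 * ∫ u in Set.Ioo (0 : ℝ) 1, u ^ k * Real.sqrt (u * (1 - u)) := by
  have h := integral_linear_pow_mul_sqrt_sq_sub_sq k 0 (1 / 2) (1 / 2) (by norm_num)
  rw [← integral_Ioc_eq_integral_Ioo, ← intervalIntegral.integral_of_le zero_le_one]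
  norm_num at h ⊢
  rw [show (∫ u in (0 : ℝ)..1, u ^ k * Real.sqrt (u * (1 - u))) =
    ∫ y in (0 : ℝ)..1, y ^ k * Real.sqrt (1 / 4 - (y - 1 / 2) ^ 2) from
      intervalIntegral.integral_congr fun u _ => by
        simp only [show u * (1 - u) = 1 / 4 - (u - 1 / 2) ^ 2 by ring], h]
  ring

theorem hasDerivAt_inv_one_add_sq (t : ℝ) :
    HasDerivAt (fun t : ℝ => 1 / (1 + t ^ 2)) (-(2 * t / (1 + t ^ 2) ^ 2)) t := by
  have h := ((hasDerivAt_pow 2 t).const_add 1).fun_inv (by positivity)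
  simpa [neg_div] using h

theorem hasDerivAt_sq_div_one_add_sq (t : ℝ) :
    HasDerivAt (fun t : ℝ => t ^ 2 / (1 + t ^ 2)) (2 * t / (1 + t ^ 2) ^ 2) t := by
  have h := (hasDerivAt_inv_one_add_sq t).const_sub 1
  rw [neg_neg] at h
  refine h.congr_of_eventuallyEq (Filter.Eventually.of_forall fun x => ?_)
  have : 1 + x ^ 2 ≠ 0 := by positivity
  simp only
  field_simp
  ring

theorem injOn_inv_one_add_sq : Set.InjOn (fun t : ℝ => 1 / (1 + t ^ 2)) (Set.Ioi 0) := by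
  intro a ha b hb hab
  have ha' : (0 : ℝ) < a := ha
  have hb' : (0 : ℝ) < b := hb
  simp only [one_div, inv_inj, add_right_inj] at hab
  exact (pow_left_inj₀ ha'.le hb'.le two_ne_zero).1 hab

theorem image_inv_one_add_sq :
    (fun t : ℝ => 1 / (1 + t ^ 2)) '' Set.Ioi 0 = Set.Ioo 0 1 := by
  ext u
  constructor
  · rintro ⟨t, ht, rfl⟩
    have ht' : (0 : ℝ) < t := ht
    refine ⟨by positivity, ?_⟩
    rw [div_lt_one (by positivity)]
    nlinarith
  · rintro ⟨h0, h1⟩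
    have hpos : 0 < (1 - u) / u := div_pos (by linarith) h0
    refine ⟨Real.sqrt ((1 - u) / u), Real.sqrt_pos.2 hpos, ?_⟩
    simp only [Real.sq_sqrt hpos.le]
    field_simp
    ring

theorem sq_div_one_add_sq_eq (t : ℝ) : t ^ 2 / (1 + t ^ 2) = 1 - 1 / (1 + t ^ 2) := by
  have : 1 + t ^ 2 ≠ 0 := by positivity
  field_simp
  ring

theorem injOn_sq_div_one_add_sq :
    Set.InjOn (fun t : ℝ => t ^ 2 / (1 + t ^ 2)) (Set.Ioi 0) := by
  intro a ha b hb hab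
  simp only [sq_div_one_add_sq_eq, sub_right_inj] at hab
  exact injOn_inv_one_add_sq ha hb hab

theorem image_sq_div_one_add_sq :
    (fun t : ℝ => t ^ 2 / (1 + t ^ 2)) '' Set.Ioi 0 = Set.Ioo 0 1 := by
  simp only [sq_div_one_add_sq_eq]
  rw [← Set.image_image (fun u : ℝ => 1 - u) (fun t : ℝ => 1 / (1 + t ^ 2)),
    image_inv_one_add_sq, Set.image_const_sub_Ioo]
  norm_num

theorem sqrt_inv_one_add_sq_mul {t : ℝ} (ht : 0 ≤ t) :
    Real.sqrt (1 / (1 + t ^ 2) * (1 - 1 / (1 + t ^ 2))) = t / (1 + t ^ 2) := by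
  have : 1 + t ^ 2 ≠ 0 := by positivity
  rw [← sq_div_one_add_sq_eq,
    show 1 / (1 + t ^ 2) * (t ^ 2 / (1 + t ^ 2)) = (t / (1 + t ^ 2)) ^ 2 by field_simp,
    Real.sqrt_sq (by positivity)]

theorem abs_deriv_smul_inv_one_add_sq (k : ℕ) {t : ℝ} (ht : 0 ≤ t) :
    |-(2 * t / (1 + t ^ 2) ^ 2)| • ((1 / (1 + t ^ 2)) ^ k *
      Real.sqrt (1 / (1 + t ^ 2) * (1 - 1 / (1 + t ^ 2)))) =
      2 * (t ^ 2 / (1 + t ^ 2) ^ (k + 3)) := by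
  have : 1 + t ^ 2 ≠ 0 := by positivity
  rw [sqrt_inv_one_add_sq_mul ht, abs_neg, abs_of_nonneg (by positivity), smul_eq_mul, div_pow,
    one_pow]
  field_simp
  ring

theorem abs_deriv_smul_sq_div_one_add_sq (k : ℕ) {t : ℝ} (ht : 0 ≤ t) :
    |2 * t / (1 + t ^ 2) ^ 2| • ((t ^ 2 / (1 + t ^ 2)) ^ k *
      Real.sqrt (t ^ 2 / (1 + t ^ 2) * (1 - t ^ 2 / (1 + t ^ 2)))) =
      2 * (t ^ 2 * t ^ (2 * k) / (1 + t ^ 2) ^ (k + 3)) := by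
  have : 1 + t ^ 2 ≠ 0 := by positivity
  have hs : Real.sqrt (t ^ 2 / (1 + t ^ 2) * (1 - t ^ 2 / (1 + t ^ 2))) = t / (1 + t ^ 2) := by
    rw [← sqrt_inv_one_add_sq_mul ht, sq_div_one_add_sq_eq]
    congr 1
    ring
  rw [hs, abs_of_nonneg (by positivity), smul_eq_mul, div_pow, ← pow_mul]
  field_simp
  ring

theorem integrableOn_pow_mul_sqrt (k : ℕ) :
    IntegrableOn (fun u : ℝ => u ^ k * Real.sqrt (u * (1 - u))) (Set.Ioo 0 1) :=
  (Continuous.integrableOn_Icc (by fun_prop)).mono_set Set.Ioo_subset_Icc_self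

theorem integral_Ioi_eq_integral_pow_mul_sqrt (k : ℕ) :
    (∫ t in Set.Ioi (0 : ℝ), t ^ 2 * (1 + t ^ (2 * k)) / (1 + t ^ 2) ^ (k + 3)) =
      ∫ u in Set.Ioo (0 : ℝ) 1, u ^ k * Real.sqrt (u * (1 - u)) := by
  set g : ℝ → ℝ := fun u => u ^ k * Real.sqrt (u * (1 - u))
  have hgi := integrableOn_pow_mul_sqrt k
  have e1 : Set.EqOn (fun t : ℝ => |-(2 * t / (1 + t ^ 2) ^ 2)| • g (1 / (1 + t ^ 2)))
      (fun t => 2 * (t ^ 2 / (1 + t ^ 2) ^ (k + 3))) (Set.Ioi 0) :=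
    fun t ht => abs_deriv_smul_inv_one_add_sq k (le_of_lt ht)
  have e2 : Set.EqOn (fun t : ℝ => |2 * t / (1 + t ^ 2) ^ 2| • g (t ^ 2 / (1 + t ^ 2)))
      (fun t => 2 * (t ^ 2 * t ^ (2 * k) / (1 + t ^ 2) ^ (k + 3))) (Set.Ioi 0) :=
    fun t ht => abs_deriv_smul_sq_div_one_add_sq k (le_of_lt ht)
  have h1 := integral_image_eq_integral_abs_deriv_smul measurableSet_Ioi
    (fun t _ => (hasDerivAt_inv_one_add_sq t).hasDerivWithinAt) injOn_inv_one_add_sq g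
  have h2 := integral_image_eq_integral_abs_deriv_smul measurableSet_Ioi
    (fun t _ => (hasDerivAt_sq_div_one_add_sq t).hasDerivWithinAt) injOn_sq_div_one_add_sq g
  have i1 := integrableOn_image_iff_integrableOn_abs_deriv_smul measurableSet_Ioi
    (fun t _ => (hasDerivAt_inv_one_add_sq t).hasDerivWithinAt) injOn_inv_one_add_sq g
  have i2 := integrableOn_image_iff_integrableOn_abs_deriv_smul measurableSet_Ioi
    (fun t _ => (hasDerivAt_sq_div_one_add_sq t).hasDerivWithinAt) injOn_sq_div_one_add_sq g
  rw [image_inv_one_add_sq] at h1 i1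
  rw [image_sq_div_one_add_sq] at h2 i2
  rw [setIntegral_congr_fun measurableSet_Ioi e1] at h1
  rw [setIntegral_congr_fun measurableSet_Ioi e2] at h2
  have j1 := (integrableOn_congr_fun e1 measurableSet_Ioi).1 (i1.1 hgi)
  have j2 := (integrableOn_congr_fun e2 measurableSet_Ioi).1 (i2.1 hgi)
  have hadd := integral_add j1 j2
  rw [← h1, ← h2] at hadd
  have hsum : (∫ t in Set.Ioi (0 : ℝ), (2 * (t ^ 2 / (1 + t ^ 2) ^ (k + 3)) +
      2 * (t ^ 2 * t ^ (2 * k) / (1 + t ^ 2) ^ (k + 3)))) =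
      2 * ∫ t in Set.Ioi (0 : ℝ), t ^ 2 * (1 + t ^ (2 * k)) / (1 + t ^ 2) ^ (k + 3) := by
    rw [← MeasureTheory.integral_const_mul]
    congr 1 with t
    ring
  rw [hsum] at hadd
  linarith

theorem integral_pow_mul_sqrt_pos (k : ℕ) :
    0 < ∫ u in Set.Ioo (0 : ℝ) 1, u ^ k * Real.sqrt (u * (1 - u)) := by
  rw [← integral_Ioc_eq_integral_Ioo, ← intervalIntegral.integral_of_le zero_le_one]
  refine intervalIntegral.intervalIntegral_pos_of_pos_on
    (Continuous.intervalIntegrable (by fun_prop) _ _) (fun u hu => ?_) zero_lt_one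
  exact mul_pos (pow_pos hu.1 k) (Real.sqrt_pos.2 (mul_pos hu.1 (by linarith [hu.2])))

/-- For every integer `k ≥ 1` there exist real constants `C_0, …, C_k`, with
`C_k = ∫_0^∞ t²(1 + t^{2k})/(1+t²)^{k+3} dt > 0`, such that for all `h > 0`,
`I_k(h) = ∫_{β(h)}^{α(h)} (1+y)^k √(h + h y − y²) dy = h (4+h) Σ_{i=0}^{k} C_i h^i`,
where `α(h) = (h + √(h(4+h)))/2` and `β(h) = (h − √(h(4+h)))/2`. -/
theorem stmt3 (k : ℕ) (hk : 1 ≤ k) :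
    ∃ C : ℕ → ℝ,
      C k = (∫ t in Set.Ioi (0 : ℝ), t ^ 2 * (1 + t ^ (2 * k)) / (1 + t ^ 2) ^ (k + 3)) ∧
      0 < C k ∧
      ∀ h : ℝ, 0 < h →
        (∫ y in ((h - Real.sqrt (h * (4 + h))) / 2)..((h + Real.sqrt (h * (4 + h))) / 2),
            (1 + y) ^ k * Real.sqrt (h + h * y - y ^ 2))
          = h * (4 + h) * ∑ i ∈ Finset.range (k + 1), C i * h ^ i := by
  have hlead : (cycleIntegralPoly k).coeff k =
      ∫ u in Set.Ioo (0 : ℝ) 1, u ^ k * Real.sqrt (u * (1 - u)) := by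
    rw [coeff_cycleIntegralPoly_self, integral_half_add_half_pow_mul_semicircle]
    ring
  refine ⟨(cycleIntegralPoly k).coeff, ?_, ?_, fun h hh => ?_⟩
  · rw [hlead, integral_Ioi_eq_integral_pow_mul_sqrt]
  · rw [hlead]
    exact integral_pow_mul_sqrt_pos k
  · rw [← Polynomial.eval_eq_sum_range'
      (Nat.lt_succ_of_le (natDegree_cycleIntegralPoly_le k))]
    set r := Real.sqrt (h * (4 + h)) / 2 with hr
    have hrpos : 0 < r := by positivity
    have hrsq : r ^ 2 = h * (4 + h) / 4 := by
      rw [hr, div_pow, Real.sq_sqrt (by positivity)]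
      norm_num
    rw [eval_cycleIntegralPoly k hrsq, sub_div, add_div, ← hr]
    have hI := integral_linear_pow_mul_sqrt_sq_sub_sq k 1 (h / 2) r hrpos
    rw [hrsq] at hI
    simp only [show ∀ y : ℝ, h + h * y - y ^ 2 = h * (4 + h) / 4 - (y - h / 2) ^ 2 from
      fun y => by ring, hI]
    ring
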